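/- arXiv:1909.09967 — 2 statements merged into one kernel-verified Lean document; each statement's English description precedes it below -/
import Mathlib

section
/- For every real ε > 0, every integer M ≥ 1, and every x ∈ ℂ that is distinct from all x_j := ε·cot((2j−1)π/(2M)), j = 1,…,M, one has ∏_{j=1}^{M} (x + iε)/(x − x_j) + ∏_{j=1}^{M} (x − iε)/(x − x_j) = 2. -/
open Real Finset

/-- The real cotangent is injective on `(0, π)`. -/
lemma injOn_cot_Ioo : Set.InjOn Real.cot (Set.Ioo 0 π) := by
  rintro a ⟨ha0, ha1⟩ b ⟨hb0, hb1⟩ h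
  have hsa := (Real.sin_pos_of_pos_of_lt_pi ha0 ha1).ne'
  have hsb := (Real.sin_pos_of_pos_of_lt_pi hb0 hb1).ne'
  rw [Real.cot_eq_cos_div_sin, Real.cot_eq_cos_div_sin, div_eq_div_iff hsa hsb] at h
  have hs : Real.sin (a - b) = 0 := by rw [Real.sin_sub]; linarith
  have := (Real.sin_eq_zero_iff_of_lt_of_lt (by linarith) (by linarith)).1 hs
  linarith

/-- `(ε cot θ + iε)^M + (ε cot θ - iε)^M` vanishes when `cos (M θ)` does. -/
lemma cot_add_I_pow_add_cot_sub_I_pow_eq_zero (ε θ : ℝ) (M : ℕ) (hθ : Real.sin θ ≠ 0)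
    (hcos : Real.cos (M * θ) = 0) :
    (((ε * Real.cot θ : ℝ) : ℂ) + Complex.I * ε) ^ M +
      (((ε * Real.cot θ : ℝ) : ℂ) - Complex.I * ε) ^ M = 0 := by
  have hs : Complex.sin (θ : ℂ) ≠ 0 := by exact_mod_cast hθ
  have hc : Complex.cos (M * (θ : ℂ)) = 0 := by exact_mod_cast hcos
  have h1 : ((ε * Real.cot θ : ℝ) : ℂ) + Complex.I * ε =
      ε / Complex.sin θ * (Complex.cos θ + Complex.sin θ * Complex.I) := by
    push_cast
    rw [Complex.cot_eq_cos_div_sin]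
    field_simp
  have h2 : ((ε * Real.cot θ : ℝ) : ℂ) - Complex.I * ε =
      ε / Complex.sin θ * (Complex.cos (-θ) + Complex.sin (-θ) * Complex.I) := by
    push_cast
    rw [Complex.cot_eq_cos_div_sin, Complex.cos_neg, Complex.sin_neg]
    field_simp
    ring
  rw [h1, h2, mul_pow, mul_pow, Complex.cos_add_sin_mul_I_pow, Complex.cos_add_sin_mul_I_pow,
    mul_neg, Complex.cos_neg, Complex.sin_neg, hc]
  ring

open Polynomial in
/-- If `(X + a)^M + (X - a)^M` vanishes at `M` distinct points, these are all its roots. -/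
lemma add_pow_add_sub_pow_eq_two_mul_prod {K : Type*} [Field K] (a : K) (M : ℕ)
    (r : ℕ → K) (hr : Set.InjOn r (Finset.range M))
    (hroot : ∀ j ∈ Finset.range M, (r j + a) ^ M + (r j - a) ^ M = 0) (x : K) :
    (x + a) ^ M + (x - a) ^ M = 2 * ∏ j ∈ Finset.range M, (x - r j) := by
  have hQ : (∏ j ∈ Finset.range M, (X - C (r j))).Monic :=
    monic_prod_of_monic _ _ fun j _ => monic_X_sub_C _
  have hQd : (∏ j ∈ Finset.range M, (X - C (r j))).degree = (M : WithBot ℕ) := by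
    simp [degree_prod]
  have hP₁ : ((X + C a) ^ M).Monic := (monic_X_add_C a).pow M
  have hP₂ : ((X - C a) ^ M).Monic := (monic_X_sub_C a).pow M
  have hd₁ : ((X + C a) ^ M).degree = (M : WithBot ℕ) := by simp [degree_pow]
  have hd₂ : ((X - C a) ^ M).degree = (M : WithBot ℕ) := by simp [degree_pow]
  have hlt₁ := degree_sub_lt_left (hd₁.trans hQd.symm) hP₁.ne_zero (hP₁.trans hQ.symm)
  have hlt₂ := degree_sub_lt_left (hd₂.trans hQd.symm) hP₂.ne_zero (hP₂.trans hQ.symm)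
  rw [hd₁] at hlt₁
  rw [hd₂] at hlt₂
  have hzero := eq_zero_of_degree_lt_of_eval_index_eq_zero (Finset.range M) hr
    (by simpa using (degree_add_le _ _).trans_lt (max_lt hlt₁ hlt₂)) (by
      intro j hj
      have hprod : ∏ i ∈ Finset.range M, (r j - r i) = 0 :=
        Finset.prod_eq_zero hj (sub_self _)
      simpa [eval_prod, hprod] using hroot j hj)
  have := congrArg (eval x) hzero
  simp only [eval_add, eval_sub, eval_pow, eval_X, eval_C, eval_prod, eval_zero] at this
  linear_combination this

/-- for real `ε > 0`, integer `M ≥ 1` and `x ∈ ℂ` distinct from all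
`x_j = ε·cot((2j−1)π/(2M))`, one has
`∏_j (x+iε)/(x−x_j) + ∏_j (x−iε)/(x−x_j) = 2`. -/
theorem dominant_eigenvalue_eq_two (ε : ℝ) (hε : 0 < ε) (M : ℕ) (hM : 1 ≤ M) (x : ℂ)
    (hx : ∀ j ∈ Finset.range M,
      x ≠ ((ε * Real.cot ((2 * (j : ℝ) + 1) * π / (2 * M)) : ℝ) : ℂ)) :
    (∏ j ∈ Finset.range M,
        (x + Complex.I * (ε : ℂ)) /
          (x - ((ε * Real.cot ((2 * (j : ℝ) + 1) * π / (2 * M)) : ℝ) : ℂ))) +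
      (∏ j ∈ Finset.range M,
        (x - Complex.I * (ε : ℂ)) /
          (x - ((ε * Real.cot ((2 * (j : ℝ) + 1) * π / (2 * M)) : ℝ) : ℂ))) = 2 := by
  have hM0 : (0 : ℝ) < M := by exact_mod_cast hM
  have hmem : ∀ j ∈ Finset.range M,
      (2 * (j : ℝ) + 1) * π / (2 * M) ∈ Set.Ioo 0 π := by
    intro j hj
    have hjM : (j : ℝ) + 1 ≤ M := by exact_mod_cast Finset.mem_range.1 hj
    refine ⟨by positivity, ?_⟩
    rw [div_lt_iff₀ (by positivity)]
    nlinarith [Real.pi_pos]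
  have hprod : ∏ j ∈ Finset.range M,
      (x - ((ε * Real.cot ((2 * (j : ℝ) + 1) * π / (2 * M)) : ℝ) : ℂ)) ≠ 0 :=
    Finset.prod_ne_zero_iff.2 fun j hj => sub_ne_zero.2 (hx j hj)
  rw [Finset.prod_div_distrib, Finset.prod_div_distrib, ← add_div, div_eq_iff hprod,
    Finset.prod_const, Finset.prod_const, Finset.card_range]
  refine add_pow_add_sub_pow_eq_two_mul_prod _ M
    (fun j : ℕ => ((ε * Real.cot ((2 * (j : ℝ) + 1) * π / (2 * M)) : ℝ) : ℂ)) ?_ ?_ x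
  · intro i hi j hj hij
    have hcot := mul_left_cancel₀ hε.ne' (Complex.ofReal_injective hij)
    have hangle := injOn_cot_Ioo (hmem i hi) (hmem j hj) hcot
    field_simp at hangle
    have : (i : ℝ) = j := by linarith
    exact_mod_cast this
  · intro j hj
    refine cot_add_I_pow_add_cot_sub_I_pow_eq_zero ε _ M
      (Real.sin_pos_of_pos_of_lt_pi (hmem j hj).1 (hmem j hj).2).ne' ?_
    refine Real.cos_eq_zero_iff.2 ⟨j, ?_⟩
    push_cast
    field_simp
end

section
/- (Algebraic Bethe Ansatz.) Let V be a complex vector space, η ∈ ℂ, and let A, B, D : ℂ → End(V), scalar functions a, d : ℂ → ℂ, and a vector Ω ∈ V be given such that: (i) A(λ)Ω = a(λ)·Ω and D(λ)Ω = d(λ)·Ω for all λ; (ii) B(λ)B(μ) = B(μ)B(λ) for all λ, μ; (iii) whenever sinh(μ−λ) ≠ 0, A(λ)B(μ) = (sinh(μ−λ+η)/sinh(μ−λ))·B(μ)A(λ) − (sinh(η)/sinh(μ−λ))·B(λ)A(μ); (iv) whenever sinh(λ−μ) ≠ 0, D(λ)B(μ) = (sinh(λ−μ+η)/sinh(λ−μ))·B(μ)D(λ)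 − (sinh(η)/sinh(λ−μ))·B(λ)D(μ). Let λ_1, …, λ_M ∈ ℂ satisfy sinh(λ_j − λ_k) ≠ 0 for all j ≠ k, set Q(λ) = ∏_{j=1}^{M} sinh(λ − λ_j), and assume the Bethe Ansatz equations a(λ_j)·Q(λ_j − η) + d(λ_j)·Q(λ_j + η) = 0 for j = 1, …, M. Then for every λ ∈ ℂ with Q(λ) ≠ 0, (A(λ) + D(λ))·B(λ_M)⋯B(λ_1)·Ω = Λ(λ)·B(λ_M)⋯B(λ_1)·Ω, where Λ(λ) = (a(λ)·Q(λ−η) + d(λ)·Q(λ+η)) / Q(λ). -/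
open Complex Finset

/-- The addition formula behind the exchange of two spectral parameters. -/
lemma sinh_exchange_identity (e l m k : ℂ) (hml : sinh (m - l) ≠ 0) (hkl : sinh (k - l) ≠ 0)
    (hkm : sinh (k - m) ≠ 0) :
    sinh (m - l + e) / sinh (m - l) * (sinh e / sinh (k - l)) -
        sinh e / sinh (m - l) * (sinh e / sinh (k - m)) =
      sinh e / sinh (k - l) * (sinh (m - k + e) / sinh (m - k)) := by
  have hneg : sinh (m - k) = -sinh (k - m) := by rw [← sinh_neg, neg_sub]
  have key : sinh (m - l + e) * sinh (k - m) - sinh e * sinh (k - l) =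
      -(sinh (m - k + e) * sinh (m - l)) := by
    rw [show k - l = (m - l) + (k - m) by ring, show m - k + e = e - (k - m) by ring]
    simp only [sinh_add, sinh_sub e (k - m)]
    ring
  rw [hneg]
  field_simp
  linear_combination sinh e * key

/-- The product of the pairwise commuting operators `B (x j)` over a finite index set. -/
noncomputable def creationProd {V ι : Type*} [AddCommGroup V] [Module ℂ V]
    (B : ℂ → Module.End ℂ V) (hBB : ∀ l m, Commute (B l) (B m)) (x : ι → ℂ) (S : Finset ι) :
    Module.End ℂ V :=
  S.noncommProd (fun j => B (x j)) (fun _ _ _ _ _ => hBB _ _)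

lemma creationProd_empty {V ι : Type*} [AddCommGroup V] [Module ℂ V]
    (B : ℂ → Module.End ℂ V) (hBB : ∀ l m, Commute (B l) (B m)) (x : ι → ℂ) :
    creationProd B hBB x ∅ = 1 :=
  noncommProd_empty _ _

lemma creationProd_insert {V ι : Type*} [AddCommGroup V] [Module ℂ V] [DecidableEq ι]
    (B : ℂ → Module.End ℂ V) (hBB : ∀ l m, Commute (B l) (B m)) (x : ι → ℂ) {S : Finset ι}
    {i : ι} (hi : i ∉ S) :
    creationProd B hBB x (insert i S) = B (x i) * creationProd B hBB x S :=
  noncommProd_insert_of_notMem _ _ _ _ hi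

/-- Action of an operator obeying a six-vertex exchange relation with `B` on a product of `B`s
applied to one of its eigenvectors: a diagonal term plus terms in which one spectral parameter has
been exchanged. -/
lemma exchange_creationProd_apply {V ι : Type*} [AddCommGroup V] [Module ℂ V] [DecidableEq ι]
    (T B : ℂ → Module.End ℂ V) (t : ℂ → ℂ) (Ω : V) (η : ℂ)
    (hT : ∀ l, T l Ω = t l • Ω) (hBB : ∀ l m, Commute (B l) (B m))
    (hTB : ∀ l m, sinh (m - l) ≠ 0 →
      T l * B m = (sinh (m - l + η) / sinh (m - l)) • (B m * T l) -
        (sinh η / sinh (m - l)) • (B l * T m))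
    (x : ι → ℂ) (hx : ∀ j k, j ≠ k → sinh (x j - x k) ≠ 0) (S : Finset ι) (l : ℂ)
    (hl : ∀ j ∈ S, sinh (x j - l) ≠ 0) :
    T l (creationProd B hBB x S Ω) =
      (t l * ∏ j ∈ S, sinh (x j - l + η) / sinh (x j - l)) •
          creationProd B hBB x S Ω -
        ∑ k ∈ S, (sinh η / sinh (x k - l) * (t (x k) *
            ∏ j ∈ S.erase k, sinh (x j - x k + η) / sinh (x j - x k))) •
          B l (creationProd B hBB x (S.erase k) Ω) := by
  induction S using Finset.induction_on generalizing l with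
  | empty => simp [hT, creationProd_empty]
  | insert i S hi ih =>
    have hil := hl i (mem_insert_self i S)
    have hSl : ∀ j ∈ S, sinh (x j - l) ≠ 0 := fun j hj => hl j (mem_insert_of_mem hj)
    have hne : ∀ j ∈ S, j ≠ i := fun j hj h => hi (h ▸ hj)
    have hSi : ∀ j ∈ S, sinh (x j - x i) ≠ 0 := fun j hj => hx j i (hne j hj)
    have hcomm : ∀ v, B (x i) (B l v) = B l (B (x i) v) := fun v =>
      LinearMap.congr_fun (hBB (x i) l) v
    have hexch := LinearMap.congr_fun (hTB l (x i) hil)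
      (creationProd B hBB x S Ω)
    simp only [Module.End.mul_apply, LinearMap.sub_apply, LinearMap.smul_apply] at hexch
    rw [creationProd_insert B hBB x hi, Module.End.mul_apply, hexch, ih l hSl,
      ih (x i) hSi, prod_insert hi, sum_insert hi, erase_insert hi]
    have hterm : ∀ k ∈ S,
        (sinh η / sinh (x k - l) * (t (x k) *
            ∏ j ∈ (insert i S).erase k, sinh (x j - x k + η) / sinh (x j - x k))) •
          B l (creationProd B hBB x ((insert i S).erase k) Ω) =
        (sinh (x i - l + η) / sinh (x i - l)) • B (x i)
          ((sinh η / sinh (x k - l) * (t (x k) *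
            ∏ j ∈ S.erase k, sinh (x j - x k + η) / sinh (x j - x k))) •
          B l (creationProd B hBB x (S.erase k) Ω)) -
        (sinh η / sinh (x i - l)) • B l
          ((sinh η / sinh (x k - x i) * (t (x k) *
            ∏ j ∈ S.erase k, sinh (x j - x k + η) / sinh (x j - x k))) •
          B (x i) (creationProd B hBB x (S.erase k) Ω)) := by
      intro k hk
      have hik : i ∉ S.erase k := fun h => hi (mem_of_mem_erase h)
      simp only [erase_insert_of_ne (hne k hk).symm, prod_insert hik,
        creationProd_insert B hBB x hik, Module.End.mul_apply, map_smul, hcomm,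
        smul_smul, ← sub_smul]
      congr 1
      linear_combination -(t (x k) *
        ∏ j ∈ S.erase k, sinh (x j - x k + η) / sinh (x j - x k)) *
        sinh_exchange_identity η l (x i) (x k) hil (hSl k hk) (hSi k hk)
    rw [sum_congr rfl hterm, sum_sub_distrib]
    simp only [map_sub, map_sum, map_smul, smul_sub, smul_sum, smul_smul]
    module

/-- Algebraic Bethe Ansatz: under the Yang–Baxter algebra
commutation relations of the six-vertex model and the Bethe Ansatz equations,
the Bethe vector `B(λ_M)⋯B(λ_1)Ω` is an eigenvector of the transfer matrix
`A(λ) + D(λ)` with eigenvalue `Λ(λ) = (a(λ)Q(λ−η) + d(λ)Q(λ+η))/Q(λ)`. -/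
theorem algebraic_bethe_ansatz
    (V : Type*) [AddCommGroup V] [Module ℂ V]
    (A B D : ℂ → Module.End ℂ V) (a d : ℂ → ℂ) (Ω : V) (η : ℂ)
    (hA : ∀ l, A l Ω = a l • Ω)
    (hD : ∀ l, D l Ω = d l • Ω)
    (hBB : ∀ l m, B l * B m = B m * B l)
    (hAB : ∀ l m, Complex.sinh (m - l) ≠ 0 →
      A l * B m = (Complex.sinh (m - l + η) / Complex.sinh (m - l)) • (B m * A l) -
        (Complex.sinh η / Complex.sinh (m - l)) • (B l * A m))
    (hDB : ∀ l m, Complex.sinh (l - m) ≠ 0 →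
      D l * B m = (Complex.sinh (l - m + η) / Complex.sinh (l - m)) • (B m * D l) -
        (Complex.sinh η / Complex.sinh (l - m)) • (B l * D m))
    (M : ℕ) (lam : Fin M → ℂ)
    (hdist : ∀ j k, j ≠ k → Complex.sinh (lam j - lam k) ≠ 0)
    (Q : ℂ → ℂ) (hQ : ∀ l, Q l = ∏ j, Complex.sinh (l - lam j))
    (hBAE : ∀ j, a (lam j) * Q (lam j - η) + d (lam j) * Q (lam j + η) = 0)
    (l : ℂ) (hl : Q l ≠ 0) :
    (A l + D l) (((List.ofFn fun j : Fin M => B (lam j)).reverse.prod) Ω) =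
      ((a l * Q (l - η) + d l * Q (l + η)) / Q l) •
        (((List.ofFn fun j : Fin M => B (lam j)).reverse.prod) Ω) := by
  have hcomm : ∀ l m, Commute (B l) (B m) := hBB
  have hprod : (List.ofFn fun j : Fin M => B (lam j)).reverse.prod =
      creationProd B hcomm lam univ := by
    have h := noncommProd_toFinset (List.finRange M).reverse (fun j => B (lam j))
      (fun _ _ _ _ _ => hcomm _ _) (List.nodup_reverse.mpr (List.nodup_finRange M))
    rw [List.ofFn_eq_map, ← List.map_reverse, ← h]
    unfold creationProd
    congr 1
    ext j
    simp
  have hlne : ∀ j, sinh (lam j - l) ≠ 0 := by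
    intro j hj
    refine hl ?_
    rw [hQ, prod_eq_zero (mem_univ j)]
    rw [← neg_sub, sinh_neg, hj, neg_zero]
  have hDB' : ∀ l m, sinh (m - l) ≠ 0 →
      D l * B m = (sinh (m - l + -η) / sinh (m - l)) • (B m * D l) -
        (sinh (-η) / sinh (m - l)) • (B l * D m) := by
    intro l m h
    have hneg : sinh (l - m) = -sinh (m - l) := by rw [← sinh_neg, neg_sub]
    rw [hDB l m (by rw [hneg]; exact neg_ne_zero.mpr h), hneg,
      show l - m + η = -(m - l + -η) by ring, sinh_neg, sinh_neg, neg_div_neg_eq, div_neg, neg_div]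
  have hratio : ∀ (S : Finset (Fin M)) (u e : ℂ),
      ∏ j ∈ S, sinh (lam j - u + e) / sinh (lam j - u) =
        (∏ j ∈ S, sinh (u - e - lam j)) / ∏ j ∈ S, sinh (u - lam j) := by
    intro S u e
    rw [← prod_div_distrib]
    refine prod_congr rfl fun j _ => ?_
    rw [← neg_div_neg_eq, ← sinh_neg, ← sinh_neg]
    congr 2 <;> ring
  have hQerase : ∀ k e, Q (lam k - e) =
      -sinh e * ∏ j ∈ univ.erase k, sinh (lam k - e - lam j) := by
    intro k e
    rw [hQ, ← mul_prod_erase univ _ (mem_univ k), ← sinh_neg]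
    congr 2
    ring
  rw [hprod, LinearMap.add_apply,
    exchange_creationProd_apply A B a Ω η hA hcomm hAB lam hdist univ l (fun j _ => hlne j),
    exchange_creationProd_apply D B d Ω (-η) hD hcomm hDB' lam hdist univ l (fun j _ => hlne j)]
  simp only [hratio]
  rw [← hQ, ← hQ, ← hQ, sub_add_sub_comm, ← sum_add_distrib, sum_eq_zero, sub_zero, ← add_smul]
  · congr 1
    rw [sub_neg_eq_add]
    ring
  · intro k _
    rw [← add_smul]
    have hbae := hBAE k
    rw [← sub_neg_eq_add (lam k) η, hQerase, hQerase] at hbae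
    convert zero_smul ℂ _ using 2
    linear_combination -(1 / sinh (lam k - l) / ∏ j ∈ univ.erase k, sinh (lam k - lam j)) * hbae
end
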